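/- arXiv:2203.06389 — 3 statements merged into one kernel-verified Lean document; each statement's English description precedes it below -/
import Mathlib

section
/- Let (q^(0), …, q^(N), r^(0), …, r^(N)) be any state obtained from the GFPush initial state by applying a finite sequence of push operations, and suppose that r^(m)_v ≤ d_v · r_max for every node v and every 0 ≤ m ≤ N−1, where r_max > 0. Then for any weights w_0, …, w_N ≥ 0 with Σ_{n=0}^{N} w_n = 1, ‖Π_s − Π̃_s‖₁ ≤ N · (2|E| + |V|) · r_max. (Theorem 1 error bound, stated for states reachable by the GFPush algorithm.) -/
open Finset Matrix

/-- The row-normalized adjacency matrix `P = D̃⁻¹ Ã` of the self-loop-augmented graph `G̃`. -/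
noncomputable def rowNormAdj (V : Type) [Fintype V] [DecidableEq V]
    (G : SimpleGraph V) [DecidableRel G.Adj] : Matrix V V ℝ :=
  Matrix.of fun v u => if u = v ∨ G.Adj v u then 1 / ((G.degree v : ℝ) + 1) else 0

/-- The GFPush initial state: `q⁽⁰⁾ = r⁽⁰⁾ = e⁽ˢ⁾` and `q⁽ⁿ⁾ = r⁽ⁿ⁾ = 0` for `1 ≤ n`. -/
noncomputable def gfInit {V : Type} [DecidableEq V] (s : V) : ℕ → V → ℝ :=
  fun n u => if n = 0 ∧ u = s then 1 else 0

/-- Effect of a push operation on node `v` at level `n'` on the family of reserve vectors: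
`q⁽ⁿ'⁾` is incremented by `(r⁽ⁿ'⁻¹⁾_v / d_v) · Σ_{u ∈ N_v} e⁽ᵘ⁾`, other levels unchanged. -/
noncomputable def pushQ {V : Type} [Fintype V] [DecidableEq V]
    (G : SimpleGraph V) [DecidableRel G.Adj]
    (q r : ℕ → V → ℝ) (v : V) (n' : ℕ) : ℕ → V → ℝ :=
  fun n u =>
    if n = n' then
      q n u + r (n' - 1) v / ((G.degree v : ℝ) + 1) * (if u = v ∨ G.Adj v u then 1 else 0)
    else q n u

/-- Effect of a push operation on node `v` at level `n'` on the family of residue vectors: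
`r⁽ⁿ'⁻¹⁾` loses its mass at `v`, and `r⁽ⁿ'⁾` is incremented by
`(r⁽ⁿ'⁻¹⁾_v / d_v) · Σ_{u ∈ N_v} e⁽ᵘ⁾`; other levels are unchanged. -/
noncomputable def pushR {V : Type} [Fintype V] [DecidableEq V]
    (G : SimpleGraph V) [DecidableRel G.Adj]
    (r : ℕ → V → ℝ) (v : V) (n' : ℕ) : ℕ → V → ℝ :=
  fun n u =>
    if n = n' - 1 then r n u - r (n' - 1) v * (if u = v then 1 else 0)
    else if n = n' then
      r n u + r (n' - 1) v / ((G.degree v : ℝ) + 1) * (if u = v ∨ G.Adj v u then 1 else 0)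
    else r n u

/-- States `(q⁽⁰⁾,…,q⁽ᴺ⁾, r⁽⁰⁾,…,r⁽ᴺ⁾)` reachable from the GFPush initial state for source `s`
by a finite sequence of push operations at levels `1 ≤ n' ≤ N`. -/
inductive GFReach {V : Type} [Fintype V] [DecidableEq V]
    (G : SimpleGraph V) [DecidableRel G.Adj] (s : V) (N : ℕ) :
    (ℕ → V → ℝ) → (ℕ → V → ℝ) → Prop
  | init : GFReach G s N (gfInit s) (gfInit s)
  | push (q r : ℕ → V → ℝ) (v : V) (n' : ℕ) (h1 : 1 ≤ n') (h2 : n' ≤ N)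
      (h : GFReach G s N q r) :
      GFReach G s N (pushQ G q r v n') (pushR G r v n')

theorem rowNormAdj_nonneg {V : Type} [Fintype V] [DecidableEq V]
    (G : SimpleGraph V) [DecidableRel G.Adj] (v u : V) : 0 ≤ rowNormAdj V G v u := by
  rw [rowNormAdj, Matrix.of_apply]
  split_ifs <;> positivity

theorem sum_rowNormAdj {V : Type} [Fintype V] [DecidableEq V]
    (G : SimpleGraph V) [DecidableRel G.Adj] (v : V) : ∑ u, rowNormAdj V G v u = 1 := by
  have hcard : #{u | u = v ∨ G.Adj v u} = G.degree v + 1 := by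
    rw [← G.card_neighborFinset_eq_degree,
      ← Finset.card_insert_of_notMem (G.notMem_neighborFinset_self v)]
    congr 1
    ext u
    simp
  simp only [rowNormAdj, Matrix.of_apply]
  rw [← Finset.sum_filter, Finset.sum_const, hcard, nsmul_eq_mul]
  push_cast
  field_simp

theorem div_degree_mul_indicator {V : Type} [Fintype V] [DecidableEq V]
    (G : SimpleGraph V) [DecidableRel G.Adj] (c : ℝ) (v u : V) :
    c / ((G.degree v : ℝ) + 1) * (if u = v ∨ G.Adj v u then 1 else 0)
      = c * rowNormAdj V G v u := by
  simp only [rowNormAdj, Matrix.of_apply]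
  split_ifs <;> ring

/-- Row-stochastic matrices act as contractions for the `L¹` norm on row vectors. -/
theorem sum_abs_vecMul_le {V : Type} [Fintype V] {P : Matrix V V ℝ}
    (hP : ∀ v u, 0 ≤ P v u) (hsum : ∀ v, ∑ u, P v u = 1) (x : V → ℝ) :
    ∑ u, |(x ᵥ* P) u| ≤ ∑ v, |x v| := by
  calc ∑ u, |(x ᵥ* P) u| ≤ ∑ u, ∑ v, |x v| * P v u := by
        refine Finset.sum_le_sum fun u _ => (Finset.abs_sum_le_sum_abs _ _).trans_eq ?_
        exact Finset.sum_congr rfl fun v _ => by rw [abs_mul, abs_of_nonneg (hP v u)]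
    _ = ∑ v, |x v| := by
        rw [Finset.sum_comm]
        simp_rw [← Finset.mul_sum, hsum, mul_one]

theorem sum_degree_add_one {V : Type} [Fintype V] [DecidableEq V]
    (G : SimpleGraph V) [DecidableRel G.Adj] :
    ∑ v, ((G.degree v : ℝ) + 1) = 2 * (G.edgeFinset.card : ℝ) + (Fintype.card V : ℝ) := by
  rw [Finset.sum_add_distrib]
  congr 1
  · exact_mod_cast G.sum_degrees_eq_twice_card_edges
  · simp

namespace GFReach

variable {V : Type} [Fintype V] [DecidableEq V] {G : SimpleGraph V} [DecidableRel G.Adj]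
  {s : V} {N : ℕ} {q r : ℕ → V → ℝ}

theorem residue_nonneg (h : GFReach G s N q r) (n : ℕ) (u : V) : 0 ≤ r n u := by
  induction h generalizing n u with
  | init => unfold gfInit; split_ifs <;> norm_num
  | push q r v n' h1 h2 h ih =>
    simp only [pushR, div_degree_mul_indicator]
    split_ifs with hn huv
    · simp [hn, huv]
    · simpa using ih n u
    · exact add_nonneg (ih n u) (mul_nonneg (ih _ v) (rowNormAdj_nonneg G v u))
    · exact ih n u

theorem reserve_zero (h : GFReach G s N q r) (u : V) : q 0 u = if u = s then 1 else 0 := by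
  induction h with
  | init => simp [gfInit]
  | push q r v n' h1 h2 h ih => simpa [pushQ, show 0 ≠ n' by lia] using ih

/-- The reserve at a level is the image under `P` of the mass already pushed out of the
preceding level. -/
theorem reserve_succ (h : GFReach G s N q r) (n : ℕ) :
    q (n + 1) = (q n - r n) ᵥ* rowNormAdj V G := by
  induction h generalizing n with
  | init => ext u; simp [gfInit]
  | push q r v n' h1 h2 h ih =>
    obtain ⟨k, rfl⟩ : ∃ k, n' = k + 1 := ⟨n' - 1, by lia⟩
    by_cases hn : n = k
    · subst hn
      have hdiff : pushQ G q r v (n + 1) n - pushR G r v (n + 1) n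
          = (q n - r n) + Pi.single v (r n v) := by
        ext u
        simp [pushQ, pushR, Pi.single_apply]
        ring
      rw [hdiff, Matrix.add_vecMul, ← ih n, Matrix.single_vecMul]
      ext u
      simp only [pushQ, div_degree_mul_indicator]
      simp
    · have hdiff : pushQ G q r v (k + 1) n - pushR G r v (k + 1) n = q n - r n := by
        ext u
        by_cases hnk : n = k + 1 <;> simp [pushQ, pushR, hn, hnk]
      rw [hdiff, ← ih n]
      ext u
      simp [pushQ, hn]

theorem sum_abs_pow_sub_reserve_le (h : GFReach G s N q r) (n : ℕ) :
    ∑ u, |(rowNormAdj V G ^ n) s u - q n u| ≤ ∑ m ∈ Finset.range n, ∑ v, r m v := by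
  induction n with
  | zero => simp [h.reserve_zero, Matrix.one_apply, eq_comm]
  | succ n ih =>
    have hstep : ∀ u, (rowNormAdj V G ^ (n + 1)) s u - q (n + 1) u
        = (((rowNormAdj V G ^ n) s - q n + r n) ᵥ* rowNormAdj V G) u := by
      intro u
      rw [h.reserve_succ, pow_succ, Matrix.mul_apply_eq_vecMul, ← Pi.sub_apply,
        ← Matrix.sub_vecMul]
      congr 2
      abel
    simp_rw [hstep]
    refine (sum_abs_vecMul_le (rowNormAdj_nonneg G) (sum_rowNormAdj G) _).trans ?_
    rw [Finset.sum_range_succ]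
    refine le_trans ?_ (add_le_add_left ih _)
    rw [← Finset.sum_add_distrib]
    refine Finset.sum_le_sum fun u _ => (abs_add_le _ _).trans_eq ?_
    rw [abs_of_nonneg (h.residue_nonneg n u), Pi.sub_apply]

end GFReach

/-- Theorem 1 error bound of "GRAND+", stated for states reachable by the GFPush algorithm:
if `(q, r)` is obtained from the GFPush initial state by a finite sequence of push operations
and `r⁽ᵐ⁾_v ≤ d_v · r_max` for every node `v` and every `0 ≤ m ≤ N-1` (with `r_max > 0`), then
for any weights `w₀, …, w_N ≥ 0` summing to `1`,
`‖Π_s − Π̃_s‖₁ ≤ N · (2|E| + |V|) · r_max`. -/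
theorem gfpush_reachable_error_bound
    {V : Type} [Fintype V] [DecidableEq V]
    (G : SimpleGraph V) [DecidableRel G.Adj]
    (s : V) (N : ℕ) (hN : 1 ≤ N)
    (q r : ℕ → V → ℝ)
    (hreach : GFReach G s N q r)
    (r_max : ℝ) (hrmax : 0 < r_max)
    (hterm : ∀ v : V, ∀ m < N, r m v ≤ ((G.degree v : ℝ) + 1) * r_max)
    (w : ℕ → ℝ) (hw : ∀ n ≤ N, 0 ≤ w n)
    (hwsum : ∑ n ∈ Finset.range (N + 1), w n = 1) :
    ∑ u, |(∑ n ∈ Finset.range (N + 1), w n * (rowNormAdj V G ^ n) s u)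
        - ∑ n ∈ Finset.range (N + 1), w n * q n u|
      ≤ (N : ℝ) * (2 * (G.edgeFinset.card : ℝ) + (Fintype.card V : ℝ)) * r_max := by
  set B : ℝ := (2 * (G.edgeFinset.card : ℝ) + (Fintype.card V : ℝ)) * r_max with hB
  have hB0 : 0 ≤ B := by positivity
  have hres : ∀ m < N, ∑ v, r m v ≤ B := fun m hm => by
    rw [hB, ← sum_degree_add_one, Finset.sum_mul]
    exact Finset.sum_le_sum fun v _ => hterm v m hm
  have hlevel : ∀ n ≤ N, ∑ u, |(rowNormAdj V G ^ n) s u - q n u| ≤ N * B := fun n hn => by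
    calc ∑ u, |(rowNormAdj V G ^ n) s u - q n u|
        ≤ ∑ m ∈ Finset.range n, ∑ v, r m v := hreach.sum_abs_pow_sub_reserve_le n
      _ ≤ ∑ _m ∈ Finset.range n, B :=
          Finset.sum_le_sum fun m hm => hres m ((Finset.mem_range.mp hm).trans_le hn)
      _ = n * B := by simp
      _ ≤ N * B := by gcongr
  have hw' : ∀ n ∈ Finset.range (N + 1), 0 ≤ w n := fun n hn =>
    hw n (Finset.mem_range_succ_iff.mp hn)
  calc ∑ u, |(∑ n ∈ Finset.range (N + 1), w n * (rowNormAdj V G ^ n) s u)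
          - ∑ n ∈ Finset.range (N + 1), w n * q n u|
      ≤ ∑ u, ∑ n ∈ Finset.range (N + 1), w n * |(rowNormAdj V G ^ n) s u - q n u| := by
        refine Finset.sum_le_sum fun u _ => ?_
        rw [← Finset.sum_sub_distrib]
        refine (Finset.abs_sum_le_sum_abs _ _).trans_eq (Finset.sum_congr rfl fun n hn => ?_)
        rw [← mul_sub, abs_mul, abs_of_nonneg (hw' n hn)]
    _ = ∑ n ∈ Finset.range (N + 1), w n * ∑ u, |(rowNormAdj V G ^ n) s u - q n u| := by
        rw [Finset.sum_comm]
        simp_rw [Finset.mul_sum]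
    _ ≤ ∑ n ∈ Finset.range (N + 1), w n * (N * B) :=
        Finset.sum_le_sum fun n hn => mul_le_mul_of_nonneg_left
          (hlevel n (Finset.mem_range_succ_iff.mp hn)) (hw' n hn)
    _ = (N : ℝ) * (2 * (G.edgeFinset.card : ℝ) + (Fintype.card V : ℝ)) * r_max := by
        rw [← Finset.sum_mul, hwsum, hB]
        ring
end

section
/- If a state (q^(0), …, q^(N), r^(0), …, r^(N)) satisfies the GFPush invariant for s, then for every node v and every level 1 ≤ n' ≤ N, the state obtained by performing a single push operation on v at level n' also satisfies the GFPush invariant for s. (Inductive step of Lemma 1: a push operation preserves the invariant at all levels n < n', n = n', and n > n'.) -/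
open Finset Matrix

/-- The residues after a push, with the entries of `P` in place of neighborhood indicators. -/
lemma pushR_eq {V : Type} [Fintype V] [DecidableEq V]
    (G : SimpleGraph V) [DecidableRel G.Adj]
    (r : ℕ → V → ℝ) (v : V) {m : ℕ} (hm : 1 ≤ m) (k : ℕ) :
    pushR G r v m k = r k
      + ((if k = m then r (m - 1) v • rowNormAdj V G v else 0)
        - (if k = m - 1 then r (m - 1) v • Pi.single v 1 else 0)) := by
  have hne : m - 1 ≠ m := by omega
  funext u
  by_cases hk : k = m - 1
  · subst hk
    simp [pushR, Pi.single_apply, hne]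
    ring
  · by_cases hk' : k = m
    · subst hk'
      simp [pushR, rowNormAdj, hk, div_eq_mul_inv]
    · simp [pushR, hk, hk']

/-- The reserves after a push, with the entries of `P` in place of neighborhood indicators. -/
lemma pushQ_eq {V : Type} [Fintype V] [DecidableEq V]
    (G : SimpleGraph V) [DecidableRel G.Adj]
    (q r : ℕ → V → ℝ) (v : V) (m n : ℕ) (u : V) :
    pushQ G q r v m n u
      = q n u + if n = m then r (m - 1) v * rowNormAdj V G v u else 0 := by
  by_cases h : n = m <;> simp [pushQ, rowNormAdj, h, div_eq_mul_inv]

/-- Pushing the row `P_v` through `i` further steps gives the row of `P ^ (i + 1)` at `v`. -/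
lemma transpose_pow_mulVec_row {V R : Type*} [Fintype V] [DecidableEq V] [CommSemiring R]
    (P : Matrix V V R) (v : V) (i : ℕ) (u : V) :
    ((P ^ i)ᵀ *ᵥ P v) u = (P ^ (i + 1)) v u := by
  rw [mulVec_transpose, pow_succ', Matrix.mul_apply']
  rfl

/-- The corrections a push introduces at levels `m` and `m - 1` telescope. -/
lemma sum_push_correction {M : Type*} [AddCommGroup M] (f : ℕ → M)
    {m : ℕ} (hm : 1 ≤ m) (n : ℕ) :
    (if n = m then f 1 else 0) + ∑ i ∈ Finset.Icc 1 n,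
      ((if n - i = m then f (i + 1) else 0) - (if n - i = m - 1 then f i else 0)) = 0 := by
  rw [Finset.sum_sub_distrib]
  rcases lt_or_ge n m with h | h
  · rw [if_neg (by omega), Finset.sum_eq_zero, Finset.sum_eq_zero]
    · simp
    all_goals
      intro i hi
      rw [Finset.mem_Icc] at hi
      exact if_neg (by omega)
  · have hlast : ∑ i ∈ Finset.Icc 1 n, (if n - i = m - 1 then f i else 0) = f (n - m + 1) := by
      rw [Finset.sum_eq_single_of_mem (n - m + 1) (Finset.mem_Icc.2 (by omega)),
        if_pos (by omega)]
      intro i hi hne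
      rw [Finset.mem_Icc] at hi
      exact if_neg (by omega)
    rw [hlast]
    rcases h.eq_or_lt with rfl | h
    · rw [Finset.sum_eq_zero]
      · simp
      · intro i hi
        rw [Finset.mem_Icc] at hi
        exact if_neg (by omega)
    · rw [if_neg (by omega),
        Finset.sum_eq_single_of_mem (n - m) (Finset.mem_Icc.2 (by omega)), if_pos (by omega)]
      · simp
      · intro i hi hne
        rw [Finset.mem_Icc] at hi
        exact if_neg (by omega)

/-- Inductive step of Lemma 1 of "GRAND+": if a state `(q, r)` satisfies the GFPush invariant
for `s`, then for every node `v` and level `1 ≤ n' ≤ N`, the state obtained by performing a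
single push operation on `v` at level `n'` also satisfies the GFPush invariant for `s`. -/
theorem gfpush_push_preserves_invariant
    {V : Type} [Fintype V] [DecidableEq V]
    (G : SimpleGraph V) [DecidableRel G.Adj]
    (s : V) (N : ℕ) (hN : 1 ≤ N)
    (q r : ℕ → V → ℝ)
    (hinv : ∀ n ≤ N, ∀ u, (rowNormAdj V G ^ n) s u
      = q n u + ∑ i ∈ Finset.Icc 1 n, ((rowNormAdj V G ^ i)ᵀ.mulVec (r (n - i))) u)
    (v : V) (n' : ℕ) (h1 : 1 ≤ n') (h2 : n' ≤ N) :
    ∀ n ≤ N, ∀ u, (rowNormAdj V G ^ n) s u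
      = pushQ G q r v n' n u
        + ∑ i ∈ Finset.Icc 1 n,
            ((rowNormAdj V G ^ i)ᵀ.mulVec (pushR G r v n' (n - i))) u := by
  intro n hn u
  set P := rowNormAdj V G with hP
  set c := r (n' - 1) v with hc
  have hterm : ∀ i, ((P ^ i)ᵀ.mulVec (pushR G r v n' (n - i))) u
      = ((P ^ i)ᵀ.mulVec (r (n - i))) u
        + ((if n - i = n' then c * (P ^ (i + 1)) v u else 0)
          - (if n - i = n' - 1 then c * (P ^ i) v u else 0)) := by
    intro i
    rw [pushR_eq G r v h1, ← hP, ← hc, mulVec_add, mulVec_sub, Pi.add_apply, Pi.sub_apply]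
    congr 2
    · split_ifs
      · rw [mulVec_smul, Pi.smul_apply, transpose_pow_mulVec_row, smul_eq_mul]
      · simp
    · split_ifs
      · rw [mulVec_smul, Pi.smul_apply, mulVec_single_one, smul_eq_mul]
        rfl
      · simp
  have hcorr := sum_push_correction (fun i => c * (P ^ i) v u) h1 n
  simp only [pow_one] at hcorr
  rw [hinv n hn u, pushQ_eq, Finset.sum_congr rfl fun i _ => hterm i, Finset.sum_add_distrib]
  linear_combination -hcorr
end

section
/- If nonnegative vectors q^(0), …, q^(N), r^(0), …, r^(N) ∈ ℝ^V satisfy the GFPush invariant for s, then for every 0 ≤ n ≤ N the approximation error of the reserve vector equals the total residue mass: ‖P^n_s − q^(n)‖₁ = Σ_{i=1}^{n} ‖r^(n−i)‖₁. -/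
open Finset Matrix

/-- The row-normalized adjacency matrix is row stochastic. -/
theorem rowNormAdj_mem_rowStochastic (V : Type) [Fintype V] [DecidableEq V]
    (G : SimpleGraph V) [DecidableRel G.Adj] : rowNormAdj V G ∈ rowStochastic ℝ V := by
  rw [mem_rowStochastic_iff_sum]
  refine ⟨fun v u => ?_, fun v => ?_⟩
  · simp only [rowNormAdj, of_apply]
    split_ifs <;> positivity
  · have hset : ({u | u = v ∨ G.Adj v u} : Finset V) = insert v (G.neighborFinset v) := by
      ext u
      simp
    simp only [rowNormAdj, of_apply]
    rw [← Finset.sum_filter, hset, Finset.sum_const, Finset.card_insert_of_notMem (by simp),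
      G.card_neighborFinset_eq_degree, nsmul_eq_mul]
    push_cast
    field_simp

/-- The transpose of a row stochastic matrix preserves the sum of the entries of a vector. -/
theorem sum_transpose_mulVec_of_mem_rowStochastic {R n : Type*} [Fintype n] [DecidableEq n]
    [Semiring R] [PartialOrder R] [IsOrderedRing R]
    {M : Matrix n n R} (hM : M ∈ rowStochastic R n) (x : n → R) :
    ∑ u, (Mᵀ.mulVec x) u = ∑ u, x u := by
  simp only [mulVec, dotProduct, transpose_apply]
  rw [Finset.sum_comm]
  simp [← Finset.sum_mul, sum_row_of_mem_rowStochastic hM]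

/-- If nonnegative vectors `q⁽⁰⁾, …, q⁽ᴺ⁾, r⁽⁰⁾, …, r⁽ᴺ⁾ ∈ ℝ^V` satisfy the GFPush invariant
for `s`, then for every `0 ≤ n ≤ N` the approximation error of the reserve vector equals the
total residue mass: `‖P^n_s − q⁽ⁿ⁾‖₁ = Σ_{i=1}^{n} ‖r⁽ⁿ⁻ⁱ⁾‖₁`. -/
theorem gfpush_error_eq_residue_mass
    {V : Type} [Fintype V] [DecidableEq V]
    (G : SimpleGraph V) [DecidableRel G.Adj]
    (s : V) (N : ℕ) (hN : 1 ≤ N)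
    (q r : ℕ → V → ℝ)
    (hq : ∀ n ≤ N, ∀ u, 0 ≤ q n u)
    (hr : ∀ n ≤ N, ∀ u, 0 ≤ r n u)
    (hinv : ∀ n ≤ N, ∀ u, (rowNormAdj V G ^ n) s u
      = q n u + ∑ i ∈ Finset.Icc 1 n, ((rowNormAdj V G ^ i)ᵀ.mulVec (r (n - i))) u) :
    ∀ n ≤ N, ∑ u, |(rowNormAdj V G ^ n) s u - q n u|
      = ∑ i ∈ Finset.Icc 1 n, ∑ u, |r (n - i) u| := by
  intro n hn
  have hP (i : ℕ) : rowNormAdj V G ^ i ∈ rowStochastic ℝ V :=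
    pow_mem (rowNormAdj_mem_rowStochastic V G) i
  have hr' (i : ℕ) (u : V) : 0 ≤ r (n - i) u := hr _ ((n.sub_le i).trans hn) u
  have herr (u : V) : |(rowNormAdj V G ^ n) s u - q n u|
      = ∑ i ∈ Finset.Icc 1 n, ((rowNormAdj V G ^ i)ᵀ.mulVec (r (n - i))) u := by
    rw [hinv n hn u, add_sub_cancel_left, abs_of_nonneg]
    exact Finset.sum_nonneg fun i _ => Finset.sum_nonneg fun v _ =>
      mul_nonneg (nonneg_of_mem_rowStochastic (hP i)) (hr' i v)
  simp_rw [herr, abs_of_nonneg (hr' _ _)]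
  rw [Finset.sum_comm]
  exact Finset.sum_congr rfl fun i _ => sum_transpose_mulVec_of_mem_rowStochastic (hP i) _
end
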